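/- Let λ = (λ_1, …, λ_k), k ≥ 4, be a k-net of order n embedded in PG(2,K) such that all lines of the component λ_1 pass through a common point, and let p > 0 be the characteristic of K. Then for each component λ_i with i > 1 there exists an elementary abelian p-group of projective collineations of PG(2,K) that leaves λ_i invariant and acts regularly (sharply transitively) on the n lines of λ_i. -/

import Mathlib

/-- The point set of the projective plane `PG(2,K)`. -/
abbrev PGPoint (K : Type*) [Field K] := Projectivization K (Fin 3 → K)

/-- The line set of `PG(2,K)`, a line being given by its dual (homogeneous)
coordinates, i.e. by a nonzero linear form up to a scalar. -/
abbrev PGLine (K : Type*) [Field K] := Projectivization K (Fin 3 → K)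

/-- Incidence between a point and a line of `PG(2,K)`. -/
def Incident {K : Type*} [Field K] (P : PGPoint K) (l : PGLine K) : Prop :=
  ∑ i, P.rep i * l.rep i = 0

/-- The cross-ratio of four (distinct, concurrent) lines of `PG(2,K)`, taken in this
order, equals `κ`:  if the first two lines have equations `r = 0` and `w = 0`, and the
other two have equations `σ•r + τ•w = 0` and `δ•r + ω•w = 0`, the cross-ratio is
`(τ/σ)·(δ/ω)`. -/
def CrossRatioLines {K : Type*} [Field K] (l₁ l₂ l₃ l₄ : PGLine K) (κ : K) : Prop :=
  ∃ (r w : Fin 3 → K) (σ τ δ ω : K) (hr : r ≠ 0) (hw : w ≠ 0)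
    (h₃ : σ • r + τ • w ≠ 0) (h₄ : δ • r + ω • w ≠ 0),
    σ ≠ 0 ∧ τ ≠ 0 ∧ δ ≠ 0 ∧ ω ≠ 0 ∧
    l₁ = Projectivization.mk K r hr ∧ l₂ = Projectivization.mk K w hw ∧
    l₃ = Projectivization.mk K (σ • r + τ • w) h₃ ∧
    l₄ = Projectivization.mk K (δ • r + ω • w) h₄ ∧
    κ = (τ / σ) * (δ / ω)

/-- A `k`-net of order `n` embedded in `PG(2,K)`: `k` pairwise disjoint sets of lines
(the components), each of size `n`, such that any two lines from distinct components
meet in a point through which passes exactly one line of each of the `k` components. -/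
structure IsNet (K : Type*) [Field K] (k n : ℕ) (Λ : Fin k → Finset (PGLine K)) : Prop where
  card_eq : ∀ i, (Λ i).card = n
  disj : ∀ i j, i ≠ j → Disjoint (Λ i) (Λ j)
  meets : ∀ i j, i ≠ j → ∀ l₁ ∈ Λ i, ∀ l₂ ∈ Λ j,
    ∃ P : PGPoint K, Incident P l₁ ∧ Incident P l₂ ∧
      ∀ m, ∃! l, l ∈ Λ m ∧ Incident P l

/-- A point of the net: a point lying on two lines from distinct components. -/
def IsNetPoint {K : Type*} [Field K] {k : ℕ} (Λ : Fin k → Finset (PGLine K))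
    (P : PGPoint K) : Prop :=
  ∃ i j, i ≠ j ∧ ∃ l₁ ∈ Λ i, ∃ l₂ ∈ Λ j, Incident P l₁ ∧ Incident P l₂

/-- A 4-net has constant cross-ratio `κ` if for every point `P` of the net, the
cross-ratio of the four lines of the net through `P`, taken in the component order,
equals `κ`. -/
def HasConstantCrossRatio {K : Type*} [Field K] (Λ : Fin 4 → Finset (PGLine K)) (κ : K) : Prop :=
  ∀ P : PGPoint K, IsNetPoint Λ P →
    ∀ l₁ ∈ Λ 0, ∀ l₂ ∈ Λ 1, ∀ l₃ ∈ Λ 2, ∀ l₄ ∈ Λ 3,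
      Incident P l₁ → Incident P l₂ → Incident P l₃ → Incident P l₄ →
        CrossRatioLines l₁ l₂ l₃ l₄ κ

/-- The action of an invertible matrix on the lines of `PG(2,K)` (in dual coordinates);
every projective collineation of `PG(2,K)` acts on the set of lines in this way. -/
noncomputable def lineCollineation {K : Type*} [Field K] (B : GL (Fin 3) K) :
    PGLine K → PGLine K :=
  Projectivization.map ((Matrix.GeneralLinearGroup.toLin B).toLinearEquiv.toLinearMap)
    (Matrix.GeneralLinearGroup.toLin B).toLinearEquiv.injective

open Polynomial in
theorem aux_form {R : Type*} [CommRing R] [IsDomain R] (H : R[X]) (T : Finset R) (n : ℕ)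
    (hn : T.card = n) (hd : H.natDegree ≤ n) (hT : ∀ t ∈ T, H.eval t = 0) :
    H = C (H.coeff n) * ∏ t ∈ T, (X - C t) := by
  set V : R[X] := ∏ t ∈ T, (X - C t) with hV
  have hVm : V.Monic := monic_prod_of_monic _ _ (fun t _ => monic_X_sub_C t)
  have hVd : V.natDegree = n := by
    rw [hV, natDegree_prod_of_monic _ _ (fun t _ => monic_X_sub_C t)]; simp [hn]
  rcases Nat.eq_zero_or_pos n with h0 | hpos
  · subst h0
    have : V = 1 := by
      rw [hV, Finset.card_eq_zero.mp hn]; simp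
    rw [this, mul_one]
    exact eq_C_of_natDegree_le_zero hd
  rw [← sub_eq_zero]
  apply eq_zero_of_natDegree_lt_card_of_eval_eq_zero' _ T
  · intro t ht
    rw [eval_sub, hT t ht, eval_mul, hV, eval_prod, Finset.prod_eq_zero ht (by simp)]
    simp
  · rw [hn]
    have hle : (H - C (H.coeff n) * V).natDegree ≤ n :=
      (natDegree_sub_le _ _).trans (max_le hd ((natDegree_C_mul_le _ _).trans hVd.le))
    refine lt_of_le_of_ne hle fun he => ?_
    have hc : (H - C (H.coeff n) * V).coeff n = 0 := by
      have : V.coeff n = 1 := by rw [← hVd]; exact hVm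
      simp [this]
    have hc2 : (H - C (H.coeff n) * V).leadingCoeff = 0 := by rw [leadingCoeff, he]; exact hc
    have h0 := leadingCoeff_eq_zero.mp hc2
    rw [h0] at he
    simp at he
    omega

open Polynomial in
theorem aux_A {K ι : Type*} [Field K] [DecidableEq ι] (F : ι → K[X]) (hF : ∀ i, (F i).natDegree ≤ 1)
    (S₂ S₃ : Finset ι) (T : Finset K) (n : ℕ) (h2 : S₂.card = n) (h3 : S₃.card = n)
    (hT : T.card = n)
    (inj : ∀ s ∈ T, ∀ f ∈ S₂, ∀ f' ∈ S₂, (F f).eval s = (F f').eval s → f = f')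
    (ex : ∀ s ∈ T, ∀ f ∈ S₂, ∃ g ∈ S₃, (F g).eval s = (F f).eval s) :
    ∃ c : K, ∀ g ∈ S₃, ∏ f ∈ S₂, (F g - F f) = C c * ∏ s ∈ T, (X - C s) := by
  refine ⟨∏ f ∈ S₂, (-(F f).coeff 1) - ∏ f ∈ S₃, (-(F f).coeff 1), fun g hg => ?_⟩
  let B : Finset ι → K[X][X] := fun S => ∏ f ∈ S, (C (F g) - (F f).map C)
  have hd1 : ∀ f, (C (F g) - (F f).map (C : K →+* K[X])).natDegree ≤ 1 := fun f =>
    (natDegree_sub_le _ _).trans (max_le (by simp) (natDegree_map_le.trans (hF f)))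
  have hd : ∀ S : Finset ι, S.card = n → (B S).natDegree ≤ n := by
    intro S hS
    refine (natDegree_prod_le _ _).trans ((Finset.sum_le_card_nsmul _ _ 1 fun f _ => hd1 f).trans ?_)
    simp [hS]
  have hco : ∀ S : Finset ι, S.card = n → (B S).coeff n = C (∏ f ∈ S, (-(F f).coeff 1)) := by
    intro S hS
    have := coeff_prod_of_natDegree_le S (fun f => C (F g) - (F f).map (C : K →+* K[X])) 1
      (fun f _ => hd1 f)
    rw [hS, mul_one] at this
    rw [this, map_prod]
    refine Finset.prod_congr rfl fun f _ => ?_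
    rw [coeff_sub, coeff_C_of_ne_zero one_ne_zero]; simp
  have hev : ∀ (S : Finset ι) (s : K), (B S).eval (C s) = ∏ f ∈ S, (F g - C ((F f).eval s)) := by
    intro S s
    rw [eval_prod]
    refine Finset.prod_congr rfl fun f _ => ?_
    simp [eval_map, eval₂_at_apply]
  have hevX : ∀ (S : Finset ι), (B S).eval X = ∏ f ∈ S, (F g - F f) := by
    intro S
    rw [eval_prod]
    refine Finset.prod_congr rfl fun f _ => ?_
    simp [eval_map]
  have key := aux_form (B S₂ - B S₃) (T.map ⟨C, C_injective⟩) n (by simpa using hT)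
    ((natDegree_sub_le _ _).trans (max_le (hd _ h2) (hd _ h3))) ?_
  · have := congrArg (eval X) key
    rw [eval_sub, hevX, hevX, coeff_sub, hco _ h2, hco _ h3, Finset.prod_eq_zero hg (by simp)] at this
    rw [sub_zero] at this
    rw [this]
    simp [eval_prod]
  · intro t ht
    obtain ⟨s, hs, rfl⟩ := Finset.mem_map.mp ht
    change eval (C s) _ = 0
    rw [eval_sub, hev, hev, sub_eq_zero]
    choose! e he1 he2 using ex s hs
    have hinj : Set.InjOn e S₂ := by
      intro a ha b hb hab
      apply inj s hs a ha b hb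
      rw [← he2 a ha, ← he2 b hb, hab]
    have him : S₂.image e = S₃ := by
      apply Finset.eq_of_subset_of_card_le
      · intro x hx
        obtain ⟨a, ha, rfl⟩ := Finset.mem_image.mp hx
        exact he1 a ha
      · rw [Finset.card_image_of_injOn hinj, h2, h3]
    rw [← him, Finset.prod_image hinj]
    refine Finset.prod_congr rfl fun f hf => by rw [he2 f hf]

open Polynomial in
theorem aux_A' {K ι : Type*} [Field K] [DecidableEq ι] (F : ι → K[X]) 
    (S₂ : Finset ι) (T : Finset K) (c : K) (g f : ι) (hf : f ∈ S₂)
    (h : ∏ f ∈ S₂, (F g - F f) = C c * ∏ s ∈ T, (X - C s)) (s : K)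
    (hfg : (F g).eval s = (F f).eval s) :
    (derivative (F g - F f)).eval s * ∏ f' ∈ S₂.erase f, ((F f).eval s - (F f').eval s) = 
      c * (derivative (∏ s ∈ T, (X - C s))).eval s := by
  rw [← Finset.mul_prod_erase _ _ hf] at h
  have := congrArg (fun q => (derivative q).eval s) h
  simp only [derivative_mul, eval_add, eval_mul, eval_sub, hfg, derivative_C] at this
  simp only [sub_self, zero_mul, add_zero, eval_zero, zero_add, eval_C, eval_prod, eval_sub, hfg] at this
  simpa [eval_prod] using this

theorem aux_C {K V : Type*} [Field K] [AddCommGroup V] [Module K V] [DecidableEq V]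
    (A B D : Finset V) (n : ℕ) (hA : A.card = n) (hB : B.card = n) (hD : D.card = n)
    (a b : K) (ha : a ≠ 0) (hb : b ≠ 0) (h : ∀ f ∈ A, ∀ g ∈ B, a • f + b • g ∈ D) :
    ∀ f₁ ∈ A, ∀ f₂ ∈ A, ∀ f₃ ∈ A, f₁ + f₂ - f₃ ∈ A := by
  intro f₁ h₁ f₂ h₂ f₃ h₃
  have hs1 : ∀ f ∈ A, B.image (fun g => a • f + b • g) = D := by
    intro f hf
    apply Finset.eq_of_subset_of_card_le
    · intro x hx
      obtain ⟨g, hg, rfl⟩ := Finset.mem_image.mp hx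
      exact h f hf g hg
    · rw [Finset.card_image_of_injective _ (fun x y hxy => by simpa [hb] using hxy), hB, hD]
  have hs2 : ∀ g ∈ B, A.image (fun f => a • f + b • g) = D := by
    intro g hg
    apply Finset.eq_of_subset_of_card_le
    · intro x hx
      obtain ⟨f, hf, rfl⟩ := Finset.mem_image.mp hx
      exact h f hf g hg
    · rw [Finset.card_image_of_injective _ (fun x y hxy => by simpa [ha] using hxy), hA, hD]
  obtain ⟨g₀, hg₀⟩ : B.Nonempty := by
    rw [← Finset.card_pos, hB, ← hA]; exact Finset.card_pos.mpr ⟨f₁, h₁⟩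
  have m1 := h f₂ h₂ g₀ hg₀
  rw [← hs1 f₃ h₃] at m1
  obtain ⟨g, hg, e1⟩ := Finset.mem_image.mp m1
  have m2 := h f₁ h₁ g hg
  rw [← hs2 g₀ hg₀] at m2
  obtain ⟨f, hf, e2⟩ := Finset.mem_image.mp m2
  have : a • f = a • (f₁ + f₂ - f₃) := by
    simp only [smul_sub, smul_add]
    have e3 : a • f = a • f₁ + b • g - b • g₀ := by rw [← e2]; abel
    have e4 : b • g = a • f₂ + b • g₀ - a • f₃ := by rw [← e1]; abel
    rw [e3, e4]; abel
  rwa [← smul_right_injective V ha this]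

theorem inc_iff_orth {K : Type*} [Field K] (P : PGPoint K) (l : PGLine K) :
    Incident P l ↔ Projectivization.orthogonal P l := by
  conv_rhs => rw [← Projectivization.mk_rep P, ← Projectivization.mk_rep l,
    Projectivization.orthogonal_mk]
  exact Iff.rfl

theorem inc_eq_or_eq {K : Type*} [Field K] {P R : PGPoint K} {l m : PGLine K}
    (h1 : Incident P l) (h2 : Incident R l) (h3 : Incident P m) (h4 : Incident R m) :
    P = R ∨ l = m := by
  rw [inc_iff_orth] at *
  exact Configuration.ofField.eq_or_eq_of_orthogonal h1 h2 h3 h4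

theorem inc_exists {K : Type*} [Field K] {l m : PGLine K} (h : l ≠ m) :
    ∃ A : PGPoint K, Incident A l ∧ Incident A m := by
  classical
  exact ⟨Projectivization.cross l m, (inc_iff_orth _ _).2 (Projectivization.cross_orthogonal_left h),
    (inc_iff_orth _ _).2 (Projectivization.cross_orthogonal_right h)⟩

/-- normalised representative of a line not through `Q` -/
noncomputable def nrep {K : Type*} [Field K] (q : Fin 3 → K) (l : PGLine K) : Fin 3 → K :=
  (q ⬝ᵥ l.rep)⁻¹ • l.rep

theorem dot_nrep {K : Type*} [Field K] (q : Fin 3 → K) (l : PGLine K) (h : q ⬝ᵥ l.rep ≠ 0) :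
    q ⬝ᵥ nrep q l = 1 := by
  simp [nrep, dotProduct_smul, h]

theorem dot_nrep_zero {K : Type*} [Field K] (q x : Fin 3 → K) (l : PGLine K)
    (h : q ⬝ᵥ l.rep ≠ 0) : x ⬝ᵥ nrep q l = 0 ↔ x ⬝ᵥ l.rep = 0 := by
  simp [nrep, dotProduct_smul, h]

theorem nrep_ne {K : Type*} [Field K] (q : Fin 3 → K) (l : PGLine K) (h : q ⬝ᵥ l.rep ≠ 0) :
    nrep q l ≠ 0 := by
  intro h0
  have := dot_nrep q l h
  rw [h0] at this
  simp at this

theorem mk_nrep {K : Type*} [Field K] (q : Fin 3 → K) (l : PGLine K) (h : q ⬝ᵥ l.rep ≠ 0) :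
    Projectivization.mk K (nrep q l) (nrep_ne q l h) = l := by
  conv_rhs => rw [← Projectivization.mk_rep l]
  rw [Projectivization.mk_eq_mk_iff']
  exact ⟨_, rfl⟩

theorem nrep_inj {K : Type*} [Field K] (q : Fin 3 → K) (l m : PGLine K) (h : q ⬝ᵥ l.rep ≠ 0)
    (h' : q ⬝ᵥ m.rep ≠ 0) (e : nrep q l = nrep q m) : l = m := by
  rw [← mk_nrep q l h, ← mk_nrep q m h']
  congr 1

theorem exists_beta {K : Type*} [Field K] (q a f : Fin 3 → K) (ha : a ≠ 0) (hqf : q ⬝ᵥ f = 1)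
    (haf : a ⬝ᵥ f = 0) :
    ∃ b : Fin 3 → K, ∀ u, q ⬝ᵥ u = 0 → a ⬝ᵥ u = 0 → b ⬝ᵥ u = 0 → u = 0 := by
  have hc : crossProduct q a ≠ 0 := by
    intro h
    have := cross_cross_eq_smul_sub_smul q a f
    rw [h, hqf, haf] at this
    simp at this
    exact ha this.symm
  obtain ⟨j, hj⟩ : ∃ j, crossProduct q a j ≠ 0 := by
    by_contra hh
    push Not at hh
    exact hc (funext hh)
  refine ⟨Pi.single j 1, fun u h1 h2 h3 => ?_⟩
  have hdet : (Matrix.of ![Pi.single j 1, q, a]).det ≠ 0 := by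
    have := triple_product_eq_det (Pi.single j 1) q a
    rw [single_one_dotProduct] at this
    change Matrix.det ![Pi.single j 1, q, a] ≠ 0
    rw [← this]; exact hj
  apply Matrix.eq_zero_of_mulVec_eq_zero hdet
  ext i
  fin_cases i
  · exact h3
  · exact h1
  · exact h2

/-- each line of a component other than the pencil misses `Q` -/
theorem net_not_through {K : Type*} [Field K] {k n : ℕ} (hn : 2 ≤ n)
    (Λ : Fin k → Finset (PGLine K)) (hnet : IsNet K k n Λ) (z : Fin k)
    (Q : PGPoint K) (hQ : ∀ l ∈ Λ z, Incident Q l) (j : Fin k) (hj : j ≠ z)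
    (l : PGLine K) (hl : l ∈ Λ j) : Q.rep ⬝ᵥ l.rep ≠ 0 := by
  intro h
  obtain ⟨v, hv, v', hv', hne⟩ := Finset.one_lt_card.mp (show 1 < (Λ z).card by
    rw [hnet.card_eq]; omega)
  obtain ⟨P, hPv, hPl, hu⟩ := hnet.meets z j hj.symm v hv l hl
  rcases inc_eq_or_eq hPv (hQ v hv) hPl h with h1 | h1
  · subst h1
    exact hne ((hu z).unique ⟨hv, hQ v hv⟩ ⟨hv', hQ v' hv'⟩)
  · subst h1
    exact Finset.disjoint_left.mp (hnet.disj z j hj.symm) hv hl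

theorem net_uniq {K : Type*} [Field K] {k n : ℕ}
    (Λ : Fin k → Finset (PGLine K)) (hnet : IsNet K k n Λ) (z j : Fin k) (hj : j ≠ z)
    (v f : PGLine K) (hv : v ∈ Λ z) (hf : f ∈ Λ j) (P : PGPoint K)
    (hPv : Incident P v) (hPf : Incident P f) : ∀ m, ∃! l, l ∈ Λ m ∧ Incident P l := by
  obtain ⟨R, hRv, hRf, hu⟩ := hnet.meets z j hj.symm v hv f hf
  rcases inc_eq_or_eq hPv hRv hPf hRf with h1 | h1
  · subst h1; exact hu
  · subst h1
    exact (Finset.disjoint_left.mp (hnet.disj z j hj.symm) hv hf).elim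

theorem net_collinear {K : Type*} [Field K] (Q P : PGPoint K) (f g v : PGLine K)
    (hf : Q.rep ⬝ᵥ f.rep ≠ 0) (hg : Q.rep ⬝ᵥ g.rep ≠ 0) (hv : Incident Q v)
    (hPf : Incident P f) (hPg : Incident P g) (hPv : Incident P v) :
    ∃ c : K, nrep Q.rep g - nrep Q.rep f = c • v.rep := by
  have hPf' : P.rep ⬝ᵥ nrep Q.rep f = 0 := (dot_nrep_zero _ _ _ hf).2 hPf
  have hPg' : P.rep ⬝ᵥ nrep Q.rep g = 0 := (dot_nrep_zero _ _ _ hg).2 hPg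
  rcases Configuration.ofField.crossProduct_eq_zero_of_dotProduct_eq_zero
    (a := Q.rep) (b := P.rep) (c := v.rep) (d := nrep Q.rep g - nrep Q.rep f) hv hPv
    (by rw [dotProduct_sub, dot_nrep _ _ hf, dot_nrep _ _ hg, sub_self])
    (by rw [dotProduct_sub, hPf', hPg', sub_self]) with h | h
  · rw [← Projectivization.mk_eq_mk_iff_crossProduct_eq_zero Q.rep_nonzero P.rep_nonzero,
      Projectivization.mk_rep, Projectivization.mk_rep] at h
    subst h
    exact (hf hPf).elim
  · by_cases h0 : nrep Q.rep g - nrep Q.rep f = 0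
    · exact ⟨0, by simpa using h0⟩
    · rw [← Projectivization.mk_eq_mk_iff_crossProduct_eq_zero v.rep_nonzero h0] at h
      obtain ⟨c, hc⟩ := (Projectivization.mk_eq_mk_iff' _ _ _ _ _).1 h.symm
      exact ⟨c, hc.symm⟩

open Polynomial in
theorem net_key {K : Type*} [Field K] {k n : ℕ} (hn : 2 ≤ n)
    (Λ : Fin k → Finset (PGLine K)) (hnet : IsNet K k n Λ) (z : Fin k)
    (Q : PGPoint K) (hQ : ∀ l ∈ Λ z, Incident Q l) (i j m : Fin k) (hi : i ≠ z) (hj : j ≠ z)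
    (hm : m ≠ z) (hij : i ≠ j) (him : i ≠ m) (hjm : j ≠ m) :
    ∃ a b : K, a ≠ 0 ∧ b ≠ 0 ∧ ∀ f ∈ Λ i, ∀ g ∈ Λ j, ∃ h ∈ Λ m,
      nrep Q.rep h = a • nrep Q.rep f + b • nrep Q.rep g := by
  classical
  have hq := net_not_through hn Λ hnet z Q hQ
  obtain ⟨f₁, hf₁, f₂, hf₂, hne⟩ := Finset.one_lt_card.mp (show 1 < (Λ i).card by
    rw [hnet.card_eq]; omega)
  obtain ⟨A, hA1, hA2⟩ := inc_exists hne
  set q := Q.rep with hqdef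
  set α := A.rep with hα
  have hαv : ∀ v ∈ Λ z, α ⬝ᵥ v.rep ≠ 0 := by
    intro v hv h0
    exact hne ((net_uniq Λ hnet z i hi v f₁ hv hf₁ A h0 hA1 i).unique ⟨hf₁, hA1⟩ ⟨hf₂, hA2⟩)
  obtain ⟨β, hβ⟩ := exists_beta q α (nrep q f₁) A.rep_nonzero (dot_nrep _ _ (hq i hi _ hf₁))
    ((dot_nrep_zero _ _ _ (hq i hi _ hf₁)).2 hA1)
  let N : PGLine K → (Fin 3 → K) := nrep q
  let F : PGLine K → K[X] := fun l => C (β ⬝ᵥ N l) - C (α ⬝ᵥ N l) * X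
  have hF : ∀ l, (F l).natDegree ≤ 1 := fun l =>
    (natDegree_sub_le _ _).trans (max_le (by simp) ((natDegree_C_mul_le _ _).trans (by simp)))
  let s : PGLine K → K := fun v => (β ⬝ᵥ v.rep) / (α ⬝ᵥ v.rep)
  have hFs : ∀ l x, (F l).eval x = β ⬝ᵥ N l - (α ⬝ᵥ N l) * x := fun l x => by simp [F]
  have hFd : ∀ l l' x, (derivative (F l - F l')).eval x = - (α ⬝ᵥ (N l - N l')) := fun l l' x => by
    simp [F, dotProduct_sub]; ring
  -- proportional vectors
  have hprop : ∀ u : Fin 3 → K, q ⬝ᵥ u = 0 → ∀ v ∈ Λ z, β ⬝ᵥ u = (α ⬝ᵥ u) * s v →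
      u = ((α ⬝ᵥ u) / (α ⬝ᵥ v.rep)) • v.rep := by
    intro u hu v hv he
    rw [← sub_eq_zero]
    have hqv : q ⬝ᵥ v.rep = 0 := hQ v hv
    have h1 := hαv v hv
    apply hβ
    · simp [dotProduct_sub, dotProduct_smul, hu, hqv]
    · simp [dotProduct_sub, dotProduct_smul, h1]
    · simp only [dotProduct_sub, dotProduct_smul, he, s, smul_eq_mul]
      ring
  have hqN : ∀ j ≠ z, ∀ f ∈ Λ j, ∀ j' ≠ z, ∀ g ∈ Λ j', q ⬝ᵥ (N g - N f) = 0 := by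
    intro j hj f hf j' hj' g hg
    simp only [N]
    rw [dotProduct_sub, dot_nrep _ _ (hq j hj f hf), dot_nrep _ _ (hq j' hj' g hg), sub_self]
  have hsame : ∀ (v : PGLine K) (c : K) (f g : PGLine K), v ∈ Λ z → N g - N f = c • v.rep →
      (F g).eval (s v) = (F f).eval (s v) := by
    intro v c f g hv he
    have h1 := hαv v hv
    have hb := congrArg (fun u => β ⬝ᵥ u) he
    have ha := congrArg (fun u => α ⬝ᵥ u) he
    simp only [dotProduct_sub, dotProduct_smul, smul_eq_mul] at ha hb
    rw [hFs, hFs]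
    simp only [s]
    field_simp
    linear_combination (α ⬝ᵥ v.rep) * hb - (β ⬝ᵥ v.rep) * ha
  have hconv : ∀ j₁ ≠ z, ∀ f ∈ Λ j₁, ∀ j₂ ≠ z, ∀ g ∈ Λ j₂, ∀ v ∈ Λ z,
      (F g).eval (s v) = (F f).eval (s v) → ∃ c : K, N g - N f = c • v.rep := by
    intro j₁ hj₁ f hf j₂ hj₂ g hg v hv he
    refine ⟨_, hprop (N g - N f) (hqN j₁ hj₁ f hf j₂ hj₂ g hg) v hv ?_⟩
    rw [hFs, hFs] at he
    simp only [dotProduct_sub]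
    linear_combination he
  have hinc : ∀ j₁ ≠ z, ∀ f ∈ Λ j₁, ∀ j₂ ≠ z, ∀ g ∈ Λ j₂, ∀ v : PGLine K, ∀ c : K,
      N g - N f = c • v.rep → ∀ P : PGPoint K, Incident P f → Incident P v → Incident P g := by
    intro j₁ hj₁ f hf j₂ hj₂ g hg v c he P hPf hPv
    have h1 : P.rep ⬝ᵥ N f = 0 := (dot_nrep_zero _ _ _ (hq j₁ hj₁ f hf)).2 hPf
    have h2 : P.rep ⬝ᵥ v.rep = 0 := hPv
    apply (dot_nrep_zero _ _ _ (hq j₂ hj₂ g hg)).1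
    have h3 : N g = N f + c • v.rep := by rw [← he]; abel
    change P.rep ⬝ᵥ N g = 0
    rw [h3, dotProduct_add, dotProduct_smul, h1, h2]; simp
  let T : Finset K := (Λ z).image s
  have hsinj : Set.InjOn s (Λ z : Set (PGLine K)) := by
    intro v hv v' hv' he
    have h1 := hαv v hv
    have h2 := hprop v.rep (hQ v hv) v' hv' (by
      rw [← he]; simp only [s]; field_simp)
    rw [← Projectivization.mk_rep v, ← Projectivization.mk_rep v',
      Projectivization.mk_eq_mk_iff']
    exact ⟨_, h2.symm⟩
  have hT : T.card = n := by rw [Finset.card_image_of_injOn hsinj, hnet.card_eq]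
  have hinjF : ∀ j₁ ≠ z, ∀ x ∈ T, ∀ f ∈ Λ j₁, ∀ f' ∈ Λ j₁,
      (F f).eval x = (F f').eval x → f = f' := by
    intro j₁ hj₁ x hx f hf f' hf' he
    obtain ⟨v, hv, rfl⟩ := Finset.mem_image.mp hx
    obtain ⟨c, hc⟩ := hconv j₁ hj₁ f' hf' j₁ hj₁ f hf v hv he
    obtain ⟨P, hPv, hPf, hu⟩ := hnet.meets z j₁ hj₁.symm v hv f' hf'
    exact (hu j₁).unique ⟨hf, hinc j₁ hj₁ f' hf' j₁ hj₁ f hf v c hc P hPf hPv⟩ ⟨hf', hPf⟩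
  have hex : ∀ j₁ ≠ z, ∀ j₂ ≠ z, ∀ x ∈ T, ∀ f ∈ Λ j₁, ∃ g ∈ Λ j₂,
      (F g).eval x = (F f).eval x := by
    intro j₁ hj₁ j₂ hj₂ x hx f hf
    obtain ⟨v, hv, rfl⟩ := Finset.mem_image.mp hx
    obtain ⟨P, hPv, hPf, hu⟩ := hnet.meets z j₁ hj₁.symm v hv f hf
    obtain ⟨g, ⟨hg, hPg⟩, -⟩ := hu j₂
    obtain ⟨c, hc⟩ := net_collinear Q P f g v (hq j₁ hj₁ f hf) (hq j₂ hj₂ g hg) (hQ v hv) hPf hPg hPv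
    exact ⟨g, hg, hsame v c f g hv hc⟩
  obtain ⟨c₃, hc₃⟩ := aux_A F hF (Λ i) (Λ j) T n (hnet.card_eq i) (hnet.card_eq j) hT
    (hinjF i hi) (hex i hi j hj)
  obtain ⟨c₄, hc₄⟩ := aux_A F hF (Λ i) (Λ m) T n (hnet.card_eq i) (hnet.card_eq m) hT
    (hinjF i hi) (hex i hi m hm)
  have hNne : ∀ j₁ ≠ z, ∀ f ∈ Λ j₁, ∀ j₂ ≠ z, ∀ g ∈ Λ j₂, j₁ ≠ j₂ → N g ≠ N f := by
    intro j₁ hj₁ f hf j₂ hj₂ g hg hjj he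
    have := nrep_inj q g f (hq j₂ hj₂ g hg) (hq j₁ hj₁ f hf) he
    subst this
    exact Finset.disjoint_left.mp (hnet.disj j₁ j₂ hjj) hf hg
  have hFne : ∀ j₁ ≠ z, ∀ f ∈ Λ j₁, ∀ j₂ ≠ z, ∀ g ∈ Λ j₂, j₁ ≠ j₂ → F g ≠ F f := by
    intro j₁ hj₁ f hf j₂ hj₂ g hg hjj he
    apply hNne j₁ hj₁ f hf j₂ hj₂ g hg hjj
    rw [← sub_eq_zero]
    have h0 := congrArg (eval 0) he
    have h1 := congrArg (eval 1) he
    rw [hFs, hFs] at h0 h1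
    apply hβ _ (hqN j₁ hj₁ f hf j₂ hj₂ g hg)
    · rw [dotProduct_sub]; linear_combination h0 - h1
    · rw [dotProduct_sub]; linear_combination h0
  have hcne : ∀ j₁ ≠ z, i ≠ j₁ → ∀ c : K,
      (∀ g ∈ Λ j₁, ∏ f ∈ Λ i, (F g - F f) = C c * ∏ s ∈ T, (X - C s)) → c ≠ 0 := by
    intro j₁ hj₁ hij₁ c hc h0
    obtain ⟨g, hg⟩ : (Λ j₁).Nonempty := by
      rw [← Finset.card_pos, hnet.card_eq]; omega
    have := hc g hg
    rw [h0, C_0, zero_mul, Finset.prod_eq_zero_iff] at this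
    obtain ⟨f, hf, he⟩ := this
    exact hFne i hi f hf j₁ hj₁ g hg hij₁ (sub_eq_zero.mp he)
  have h3 := hcne j hj hij c₃ hc₃
  have h4 := hcne m hm him c₄ hc₄
  -- the main relation
  have main : ∀ f ∈ Λ i, ∀ g ∈ Λ j, ∃ h ∈ Λ m, N h - N f = (c₄ / c₃) • (N g - N f) := by
    intro f hf g hg
    obtain ⟨P, hPf, hPg, hu⟩ := hnet.meets i j hij f hf g hg
    obtain ⟨v, ⟨hv, hPv⟩, -⟩ := hu z
    obtain ⟨h, ⟨hh, hPh⟩, -⟩ := hu m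
    refine ⟨h, hh, ?_⟩
    obtain ⟨a, ha⟩ := net_collinear Q P f g v (hq i hi f hf) (hq j hj g hg) (hQ v hv) hPf hPg hPv
    obtain ⟨b, hb⟩ := net_collinear Q P f h v (hq i hi f hf) (hq m hm h hh) (hQ v hv) hPf hPh hPv
    have e1 := aux_A' F (Λ i) T c₃ g f hf (hc₃ g hg) (s v) (hsame v a f g hv ha)
    have e2 := aux_A' F (Λ i) T c₄ h f hf (hc₄ h hh) (s v) (hsame v b f h hv hb)
    have ha' : N g - N f = a • v.rep := ha
    have hb' : N h - N f = b • v.rep := hb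
    rw [hFd, ha', dotProduct_smul, smul_eq_mul] at e1
    rw [hFd, hb', dotProduct_smul, smul_eq_mul] at e2
    have hD : ∏ f' ∈ (Λ i).erase f, ((F f).eval (s v) - (F f').eval (s v)) ≠ 0 := by
      rw [Finset.prod_ne_zero_iff]
      intro f' hf' h0
      rw [Finset.mem_erase] at hf'
      exact hf'.1 (hinjF i hi (s v) (Finset.mem_image_of_mem _ hv) f hf f' hf'.2
        (sub_eq_zero.mp h0)).symm
    have hv1 := hαv v hv
    have : b * c₃ = a * c₄ := by
      apply mul_right_cancel₀ (mul_ne_zero hv1 hD)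
      linear_combination (-c₃) * e2 + c₄ * e1
    rw [ha', hb', smul_smul]
    congr 1
    field_simp
    linear_combination this
  refine ⟨1 - c₄ / c₃, c₄ / c₃, ?_, div_ne_zero h4 h3, ?_⟩
  · intro h0
    have h1 : c₄ / c₃ = 1 := by linear_combination -h0
    obtain ⟨g, hg⟩ : (Λ j).Nonempty := by
      rw [← Finset.card_pos, hnet.card_eq]; omega
    obtain ⟨h, hh, he⟩ := main f₁ hf₁ g hg
    rw [h1, one_smul] at he
    exact hNne j hj g hg m hm h hh hjm (sub_left_injective he)
  · intro f hf g hg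
    obtain ⟨h, hh, he⟩ := main f hf g hg
    refine ⟨h, hh, ?_⟩
    have : N h = N f + (c₄ / c₃) • (N g - N f) := by rw [← he]; abel
    change N h = _
    rw [this]
    simp only [N, smul_sub, sub_smul, one_smul]
    abel

theorem shear_mul {K : Type*} [Field K] (q x y : Fin 3 → K) (h : q ⬝ᵥ y = 0) :
    (1 + Matrix.vecMulVec x q) * (1 + Matrix.vecMulVec y q) = 1 + Matrix.vecMulVec (x + y) q := by
  rw [mul_add, add_mul, add_mul, Matrix.vecMulVec_mul_vecMulVec, h, Matrix.add_vecMulVec]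
  simp [add_assoc]

/-- the elation matrix -/
noncomputable def shear {K : Type*} [Field K] (q x : Fin 3 → K) (h : q ⬝ᵥ x = 0) :
    GL (Fin 3) K where
  val := 1 + Matrix.vecMulVec x q
  inv := 1 + Matrix.vecMulVec (-x) q
  val_inv := by rw [shear_mul q x (-x) (by simp [h])]; simp
  inv_val := by rw [shear_mul q (-x) x h]; simp

theorem lineColl_mul {K : Type*} [Field K] (B B' : GL (Fin 3) K) (l : PGLine K) :
    lineCollineation (B * B') l = lineCollineation B (lineCollineation B' l) := by
  induction l using Projectivization.ind with | h v hv =>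
  simp only [lineCollineation, Projectivization.map_mk]
  congr 1
  simp

theorem lineColl_one {K : Type*} [Field K] (l : PGLine K) :
    lineCollineation (1 : GL (Fin 3) K) l = l := by
  induction l using Projectivization.ind with | h v hv =>
  simp only [lineCollineation, Projectivization.map_mk]
  congr 1
  simp

theorem lineColl_shear {K : Type*} [Field K] (q x : Fin 3 → K) (h : q ⬝ᵥ x = 0)
    (v : Fin 3 → K) (hv : v ≠ 0) (hv' : v + (q ⬝ᵥ v) • x ≠ 0) :
    lineCollineation (shear q x h) (Projectivization.mk K v hv) =
      Projectivization.mk K (v + (q ⬝ᵥ v) • x) hv' := by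
  simp only [lineCollineation, Projectivization.map_mk]
  congr 1
  change (1 + Matrix.vecMulVec x q).mulVec v = _
  rw [Matrix.add_mulVec, Matrix.vecMulVec_mulVec]
  simp

/-- the additive group of translations preserving a finite set -/
def stabGrp {K : Type*} [Field K] (q : Fin 3 → K) (S : Finset (Fin 3 → K)) :
    AddSubgroup (Fin 3 → K) where
  carrier := {x | q ⬝ᵥ x = 0 ∧ ∀ f, f ∈ S ↔ f + x ∈ S}
  zero_mem' := by simp
  add_mem' := by
    rintro x y ⟨hx, hx'⟩ ⟨hy, hy'⟩
    refine ⟨by rw [dotProduct_add, hx, hy, add_zero], fun f => ?_⟩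
    rw [hx', hy', add_assoc]
  neg_mem' := by
    rintro x ⟨hx, hx'⟩
    refine ⟨by rw [dotProduct_neg, hx, neg_zero], fun f => ?_⟩
    rw [hx' (f + -x)]; simp

/-- the group of elations with translations in `H` -/
noncomputable def elGrp {K : Type*} [Field K] (q : Fin 3 → K) (H : AddSubgroup (Fin 3 → K))
    (hH : ∀ x ∈ H, q ⬝ᵥ x = 0) : Subgroup (Equiv.Perm (PGLine K)) where
  carrier := {g | ∃ x, ∃ hx : x ∈ H, ⇑g = lineCollineation (shear q x (hH x hx))}
  one_mem' := by
    refine ⟨0, H.zero_mem, ?_⟩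
    funext l
    have : shear q 0 (hH 0 H.zero_mem) = 1 := by ext; simp [shear]
    rw [this, lineColl_one]; rfl
  mul_mem' := by
    rintro g g' ⟨x, hx, hg⟩ ⟨y, hy, hg'⟩
    refine ⟨x + y, H.add_mem hx hy, ?_⟩
    funext l
    have : shear q (x + y) (hH _ (H.add_mem hx hy)) = shear q x (hH x hx) * shear q y (hH y hy) :=
      Units.ext (shear_mul q x y (hH y hy)).symm
    rw [this, lineColl_mul, ← hg, ← hg']; rfl
  inv_mem' := by
    rintro g ⟨x, hx, hg⟩
    refine ⟨-x, H.neg_mem hx, ?_⟩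
    funext l
    rw [Equiv.Perm.inv_eq_iff_eq, hg, ← lineColl_mul]
    have : shear q x (hH x hx) * shear q (-x) (hH _ (H.neg_mem hx)) = 1 := by
      apply Units.ext
      change (1 + Matrix.vecMulVec x q) * (1 + Matrix.vecMulVec (-x) q) = 1
      rw [shear_mul q x (-x) (hH _ (H.neg_mem hx))]; simp
    rw [this, lineColl_one]

theorem shear_congr {K : Type*} [Field K] (q x y : Fin 3 → K) (h : q ⬝ᵥ x = 0) (h' : q ⬝ᵥ y = 0)
    (e : x = y) : shear q x h = shear q y h' := by
  subst e; rfl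

/-- Let `λ` be a `k`-net (`k ≥ 4`) of order `n` embedded in `PG(2,K)`, with `K` of
characteristic `p > 0`, whose first component is contained in a line pencil. Then for
each further component `λ_i` there is an elementary abelian `p`-group of projective
collineations leaving `λ_i` invariant and acting regularly on its `n` lines. -/
theorem pencil_component_regular_group {K : Type*} [Field K]
    (p : ℕ) (hp : 0 < p) [CharP K p]
    (k n : ℕ) (hk : 4 ≤ k) (Λ : Fin k → Finset (PGLine K)) (hnet : IsNet K k n Λ)
    (Q : PGPoint K) (hQ : ∀ l ∈ Λ ⟨0, by omega⟩, Incident Q l)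
    (i : Fin k) (hi : i ≠ ⟨0, by omega⟩) :
    ∃ G : Subgroup (Equiv.Perm (PGLine K)),
      (∀ g ∈ G, ∃ B : GL (Fin 3) K, ⇑g = lineCollineation B) ∧
      (∀ g ∈ G, ∀ g' ∈ G, g * g' = g' * g) ∧
      (∀ g ∈ G, g ≠ 1 → orderOf g = p) ∧
      (∀ g ∈ G, ∀ l ∈ Λ i, g l ∈ Λ i) ∧
      (∀ l₁ ∈ Λ i, ∀ l₂ ∈ Λ i, ∃! g, g ∈ G ∧ g l₁ = l₂) := by
  classical
  rcases Nat.lt_or_ge n 2 with hn | hn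
  · have hsub : ∀ l₁ ∈ Λ i, ∀ l₂ ∈ Λ i, l₁ = l₂ :=
      Finset.card_le_one.mp (by rw [hnet.card_eq]; omega)
    refine ⟨⊥, ?_, ?_, ?_, ?_, ?_⟩
    · intro g hg
      rw [Subgroup.mem_bot] at hg
      refine ⟨1, ?_⟩
      funext l
      rw [lineColl_one, hg]; rfl
    · intro g hg g' hg'
      rw [Subgroup.mem_bot] at hg hg'
      rw [hg, hg']
    · intro g hg hne
      exact (hne (Subgroup.mem_bot.mp hg)).elim
    · intro g hg l hl
      rw [Subgroup.mem_bot.mp hg]; exact hl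
    · intro l₁ h₁ l₂ h₂
      refine ⟨1, ⟨Subgroup.one_mem _, hsub l₁ h₁ l₂ h₂⟩, ?_⟩
      rintro g ⟨hg, -⟩
      exact Subgroup.mem_bot.mp hg
  obtain ⟨z, hz⟩ : ∃ z : Fin k, z = ⟨0, by omega⟩ := ⟨_, rfl⟩
  rw [← hz] at hQ hi
  obtain ⟨j, hj⟩ : ∃ j : Fin k, j ∉ ({z, i} : Finset (Fin k)) := by
    by_contra hh
    push Not at hh
    have := Finset.card_le_card (fun x _ => hh x : (Finset.univ : Finset (Fin k)) ⊆ {z, i})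
    have h2 := Finset.card_le_two (a := z) (b := i)
    simp only [Finset.card_univ, Fintype.card_fin] at this
    omega
  obtain ⟨m, hm⟩ : ∃ m : Fin k, m ∉ ({z, i, j} : Finset (Fin k)) := by
    by_contra hh
    push Not at hh
    have := Finset.card_le_card (fun x _ => hh x : (Finset.univ : Finset (Fin k)) ⊆ {z, i, j})
    have h2 := Finset.card_le_three (a := z) (b := i) (c := j)
    simp only [Finset.card_univ, Fintype.card_fin] at this
    omega
  simp only [Finset.mem_insert, Finset.mem_singleton, not_or] at hj hm
  have hq := net_not_through hn Λ hnet z Q hQ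
  obtain ⟨a, b, ha, hb, hab⟩ := net_key hn Λ hnet z Q hQ i j m hi hj.1 hm.1 (Ne.symm hj.2)
    (Ne.symm hm.2.1) (Ne.symm hm.2.2)
  set q := Q.rep with hqd
  have hcard : ∀ j₁ ≠ z, ((Λ j₁).image (nrep q)).card = n := by
    intro j₁ hj₁
    rw [Finset.card_image_of_injOn, hnet.card_eq]
    intro x hx y hy e
    exact nrep_inj q x y (hq j₁ hj₁ x hx) (hq j₁ hj₁ y hy) e
  have hcos := aux_C ((Λ i).image (nrep q)) ((Λ j).image (nrep q)) ((Λ m).image (nrep q)) n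
    (hcard i hi) (hcard j hj.1) (hcard m hm.1) a b ha hb (by
      intro f hf g hg
      obtain ⟨f', hf', rfl⟩ := Finset.mem_image.mp hf
      obtain ⟨g', hg', rfl⟩ := Finset.mem_image.mp hg
      obtain ⟨h, hh, e⟩ := hab f' hf' g' hg'
      rw [← e]
      exact Finset.mem_image_of_mem _ hh)
  set S := (Λ i).image (nrep q) with hS
  have hH : ∀ x ∈ stabGrp q S, q ⬝ᵥ x = 0 := fun x hx => hx.1
  -- action on lines
  have hact : ∀ x (hx : q ⬝ᵥ x = 0), ∀ l ∈ Λ i, ∃ h0 : nrep q l + x ≠ 0,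
      lineCollineation (shear q x hx) l = Projectivization.mk K (nrep q l + x) h0 := by
    intro x hx l hl
    have h1 := hq i hi l hl
    have h0 : nrep q l + x ≠ 0 := by
      intro h
      have := congrArg (fun u => q ⬝ᵥ u) h
      simp [dotProduct_add, dot_nrep _ _ h1, hx] at this
    refine ⟨h0, ?_⟩
    have hd := dot_nrep q l h1
    have := lineColl_shear q x hx (nrep q l) (nrep_ne q l h1) (by rw [hd, one_smul]; exact h0)
    rw [mk_nrep q l h1] at this
    rw [this]
    congr 1
    rw [hd, one_smul]
  have hto : ∀ x (hx : q ⬝ᵥ x = 0), ∀ l ∈ Λ i, ∀ l' ∈ Λ i, nrep q l' = nrep q l + x →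
      lineCollineation (shear q x hx) l = l' := by
    intro x hx l hl l' hl' e
    obtain ⟨h0, h1⟩ := hact x hx l hl
    rw [h1, ← mk_nrep q l' (hq i hi l' hl')]
    congr 1
    exact e.symm
  refine ⟨elGrp q (stabGrp q S) hH, ?_, ?_, ?_, ?_, ?_⟩
  · rintro g ⟨x, hx, hg⟩
    exact ⟨_, hg⟩
  · rintro g ⟨x, hx, hg⟩ g' ⟨y, hy, hg'⟩
    apply Equiv.ext
    intro l
    rw [Equiv.Perm.mul_apply, Equiv.Perm.mul_apply, hg, hg', ← lineColl_mul, ← lineColl_mul]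
    congr 1
    apply Units.ext
    change (1 + Matrix.vecMulVec x q) * (1 + Matrix.vecMulVec y q) =
      (1 + Matrix.vecMulVec y q) * (1 + Matrix.vecMulVec x q)
    rw [shear_mul _ _ _ hy.1, shear_mul _ _ _ hx.1, add_comm x y]
  · rintro g ⟨x, hx, hg⟩ hne
    have hprime : p.Prime := (CharP.char_is_prime_or_zero K p).resolve_right hp.ne'
    haveI : Fact p.Prime := ⟨hprime⟩
    apply orderOf_eq_prime _ hne
    have hpow : ∀ r : ℕ, ∃ h : q ⬝ᵥ ((r : K) • x) = 0,
        ⇑(g ^ r) = lineCollineation (shear q ((r : K) • x) h) := by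
      intro r
      induction r with
      | zero =>
        refine ⟨by simp, ?_⟩
        funext l
        have : shear q (((0 : ℕ) : K) • x) (by simp) = 1 := by ext; simp [shear]
        rw [this, lineColl_one]; simp
      | succ r ih =>
        obtain ⟨h, e⟩ := ih
        refine ⟨by rw [dotProduct_smul, hx.1, smul_zero], ?_⟩
        funext l
        rw [pow_succ, Equiv.Perm.mul_apply, e, hg, ← lineColl_mul]
        congr 1
        apply Units.ext
        change (1 + Matrix.vecMulVec ((r : K) • x) q) * (1 + Matrix.vecMulVec x q) =
          1 + Matrix.vecMulVec (((r + 1 : ℕ) : K) • x) q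
        rw [shear_mul _ _ _ hx.1]
        push_cast
        rw [add_smul, one_smul]
    obtain ⟨h, e⟩ := hpow p
    apply Equiv.ext
    intro l
    have : shear q ((p : K) • x) h = 1 := by ext; simp [shear]
    rw [e, this, lineColl_one]; rfl
  · rintro g ⟨x, hx, hg⟩ l hl
    have h1 : nrep q l + x ∈ S := (hx.2 _).1 (Finset.mem_image_of_mem _ hl)
    obtain ⟨l', hl', e⟩ := Finset.mem_image.mp h1
    rw [hg, hto x hx.1 l hl l' hl' e]
    exact hl'
  · intro l₁ h₁ l₂ h₂
    have m1 : nrep q l₁ ∈ S := Finset.mem_image_of_mem _ h₁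
    have m2 : nrep q l₂ ∈ S := Finset.mem_image_of_mem _ h₂
    have hx : nrep q l₂ - nrep q l₁ ∈ stabGrp q S := by
      refine ⟨?_, fun f => ⟨fun hf => ?_, fun hf => ?_⟩⟩
      · rw [dotProduct_sub, dot_nrep _ _ (hq i hi _ h₁), dot_nrep _ _ (hq i hi _ h₂), sub_self]
      · have := hcos f hf _ m2 _ m1
        rwa [add_sub_assoc] at this
      · have := hcos _ hf _ m1 _ m2
        have e : f + (nrep q l₂ - nrep q l₁) + nrep q l₁ - nrep q l₂ = f := by abel
        rwa [e] at this
    have hgrp : ∀ x (hx : x ∈ stabGrp q S), ∃ g : Equiv.Perm (PGLine K),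
        ⇑g = lineCollineation (shear q x (hH x hx)) := by
      intro x hx
      refine ⟨⟨lineCollineation (shear q x (hH x hx)),
        lineCollineation (shear q x (hH x hx))⁻¹, fun l => ?_, fun l => ?_⟩, rfl⟩
      · rw [← lineColl_mul, inv_mul_cancel, lineColl_one]
      · rw [← lineColl_mul, mul_inv_cancel, lineColl_one]
    obtain ⟨g, hg⟩ := hgrp _ hx
    have hgl : g l₁ = l₂ := by
      rw [hg]
      exact hto _ _ l₁ h₁ l₂ h₂ (by abel)
    refine ⟨g, ⟨⟨_, hx, hg⟩, hgl⟩, ?_⟩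
    rintro g' ⟨⟨y, hy, hg'⟩, hgl'⟩
    have h3 : nrep q l₁ + y ∈ S := (hy.2 _).1 m1
    obtain ⟨l', hl', e⟩ := Finset.mem_image.mp h3
    have h4 := hto y hy.1 l₁ h₁ l' hl' e
    rw [← hg', hgl'] at h4
    subst h4
    have hxy : y = nrep q l₂ - nrep q l₁ := by rw [e]; abel
    apply DFunLike.coe_injective
    rw [hg, hg']
    congr 1
    exact shear_congr _ _ _ _ _ hxy
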